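/- Let N and m be positive integers with 1 ≤ m ≤ N. Then 0 ≤ (π m)² − 4N² sin²(π m/(2N)) ≤ π⁴ m⁴ / (12 N²). In particular the finite difference eigenvalues underestimate the exact Dirichlet eigenvalues and the relative error is of second order in the mesh size h = 1/N. -/

import Mathlib

open Real

theorem sq_sub_pow_four_div_three_le_sin_sq (x : ℝ) : x ^ 2 - x ^ 4 / 3 ≤ sin x ^ 2 := by
  wlog hx : 0 ≤ x generalizing x
  · simpa [Even.neg_pow (by decide : Even 4)] using this (-x) (by linarith)
  have h := sin_ge_sub_cube hx
  rcases le_total (x ^ 2) 6 with h6 | h6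
  · have h0 : 0 ≤ x - x ^ 3 / 6 := by nlinarith
    nlinarith [pow_le_pow_left₀ h0 h 2, sq_nonneg (x ^ 3)]
  · nlinarith [sq_nonneg (sin x)]

/-- For positive integers `m ≤ N`, the finite difference eigenvalue
`4 N² sin² (π m/(2N))` underestimates the exact Dirichlet eigenvalue `(π m)²`, and
`0 ≤ (π m)² − 4 N² sin² (π m/(2N)) ≤ π⁴ m⁴ / (12 N²)`:
the error is of second order in the mesh size `h = 1/N`. -/
theorem fd_eigenvalues_error_bound (N m : ℕ) (hN : 0 < N) (hm : 1 ≤ m) (hmN : m ≤ N) :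
    0 ≤ (π * m) ^ 2 - 4 * (N : ℝ) ^ 2 * Real.sin (π * m / (2 * N)) ^ 2 ∧
    (π * m) ^ 2 - 4 * (N : ℝ) ^ 2 * Real.sin (π * m / (2 * N)) ^ 2 ≤
      π ^ 4 * m ^ 4 / (12 * (N : ℝ) ^ 2) := by
  have hN' : (N : ℝ) ≠ 0 := by positivity
  set x : ℝ := π * m / (2 * N) with hx
  have h_sq : (π * m) ^ 2 = 4 * (N : ℝ) ^ 2 * x ^ 2 := by
    rw [hx]; field_simp; ring
  have h_four : π ^ 4 * m ^ 4 / (12 * (N : ℝ) ^ 2) = 4 * (N : ℝ) ^ 2 * (x ^ 4 / 3) := by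
    rw [hx]; field_simp; ring
  rw [h_sq, h_four, ← mul_sub]
  constructor
  · exact mul_nonneg (by positivity) (sub_nonneg.2 (sq_le_sq.2 abs_sin_le_abs))
  · gcongr
    linarith [sq_sub_pow_four_div_three_le_sin_sq x]
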